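/- Suppose w ∈ S_n avoids the pattern 321 and contains exactly one occurrence of the pattern 3412 (that is, there is exactly one 4-tuple of indices i_1 < i_2 < i_3 < i_4 such that w(i_1)w(i_2)w(i_3)w(i_4) is in the relative order 3412). Let ℓ = ℓ(w). Then the principal Bruhat order ideal B(w) has cardinality |B(w)| = 7·2^{ℓ−3}. -/

import Mathlib

namespace Paper

/-! ### Type A: the symmetric group `S_n` as `Equiv.Perm (Fin n)` -/

/-- The simple transposition `s_i ∈ S_n` (1-indexed letter `i`, meaningful for
`1 ≤ i ≤ n-1`): it interchanges the entries in (1-indexed) positions `i` and `i+1`,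
i.e. (0-indexed) positions `i-1` and `i` of `Fin n`. Out-of-range letters give `1`. -/
def sA (n : ℕ) (i : ℕ) : Equiv.Perm (Fin n) :=
  if h : 1 ≤ i ∧ i < n then Equiv.swap ⟨i - 1, by omega⟩ ⟨i, h.2⟩ else 1

/-- The product `s_{i_1} ⋯ s_{i_ℓ}` of a word `i_1 ⋯ i_ℓ`. -/
def prodA (n : ℕ) (w : List ℕ) : Equiv.Perm (Fin n) := (w.map (sA n)).prod

/-- A word in the letters `{1, …, n-1}`. -/
def IsWordA (n : ℕ) (w : List ℕ) : Prop := ∀ i ∈ w, 1 ≤ i ∧ i ≤ n - 1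

/-- `w` is a reduced decomposition of `x ∈ S_n`. -/
def ReducedA (n : ℕ) (w : List ℕ) (x : Equiv.Perm (Fin n)) : Prop :=
  IsWordA n w ∧ prodA n w = x ∧
    ∀ w' : List ℕ, IsWordA n w' → prodA n w' = x → w.length ≤ w'.length

/-- The Coxeter length `ℓ(x)`: minimal length of a word for `x`. -/
noncomputable def lenA (n : ℕ) (x : Equiv.Perm (Fin n)) : ℕ :=
  sInf {l | ∃ w : List ℕ, IsWordA n w ∧ prodA n w = x ∧ w.length = l}

/-- Bruhat order on `S_n`: `v ≤ w` iff some reduced decomposition of `v` is a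
(not necessarily consecutive) subword of some reduced decomposition of `w`. -/
def bruhatA (n : ℕ) (v w : Equiv.Perm (Fin n)) : Prop :=
  ∃ a b : List ℕ, ReducedA n a v ∧ ReducedA n b w ∧ a.Sublist b

/-- `w ∈ S_n` is boolean: the principal order ideal `B(w)`, ordered by the Bruhat
order, is order-isomorphic to the lattice of all subsets of `{1,…,r}` for some `r`. -/
def BooleanA (n : ℕ) (w : Equiv.Perm (Fin n)) : Prop :=
  ∃ (r : ℕ) (e : {v : Equiv.Perm (Fin n) // bruhatA n v w} ≃ Finset (Fin r)),
    ∀ a b : {v : Equiv.Perm (Fin n) // bruhatA n v w}, bruhatA n a.1 b.1 ↔ e a ⊆ e b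

/-- Pattern containment: `w ∈ S_n` contains `p ∈ S_k`. -/
def ContainsA {n k : ℕ} (w : Equiv.Perm (Fin n)) (p : Equiv.Perm (Fin k)) : Prop :=
  ∃ f : Fin k → Fin n, StrictMono f ∧ ∀ a b : Fin k, w (f a) < w (f b) ↔ p a < p b

/-- Pattern avoidance. -/
def AvoidsA {n k : ℕ} (w : Equiv.Perm (Fin n)) (p : Equiv.Perm (Fin k)) : Prop :=
  ¬ ContainsA w p

/-- The pattern `321` (one-line notation). -/
def p321 : Equiv.Perm (Fin 3) := ⟨![2,1,0], ![2,1,0], by decide, by decide⟩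
/-- The pattern `231` (one-line notation). -/
def p231 : Equiv.Perm (Fin 3) := ⟨![1,2,0], ![2,0,1], by decide, by decide⟩
/-- The pattern `312` (one-line notation). -/
def p312 : Equiv.Perm (Fin 3) := ⟨![2,0,1], ![1,2,0], by decide, by decide⟩
/-- The pattern `3412` (one-line notation). -/
def p3412 : Equiv.Perm (Fin 4) := ⟨![2,3,0,1], ![2,3,0,1], by decide, by decide⟩

/-- The longest (decreasing) permutation `w_0^{(k)} = k (k-1) ⋯ 2 1 ∈ S_k`. -/
def w0 (k : ℕ) : Equiv.Perm (Fin k) := Fin.revPerm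

/-- The shift of a word by `M`: each letter `i` becomes `i + M`. -/
def shift (M : ℕ) (w : List ℕ) : List ℕ := w.map (· + M)




/-! ### Types B and D: signed permutations, modelled as permutations `w` of `ℤ`
with `w(-x) = -w(x)` that fix all integers of absolute value `> n`. -/

/-- The simple generators of `S_n^B`, as permutations of `ℤ`:
`sB 0` negates the value `1`; for `i ≥ 1`, `sB i` interchanges the values
`i` and `i+1` (and `-i` and `-(i+1)`). -/
def sB : ℕ → Equiv.Perm ℤ
  | 0 => Equiv.swap 1 (-1)
  | (i+1) => Equiv.swap ((i : ℤ) + 1) ((i : ℤ) + 2) * Equiv.swap (-((i : ℤ) + 1)) (-((i : ℤ) + 2))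

/-- The simple generators of `S_n^D`: letter `0` encodes `s_{1'} = s_0 s_1 s_0`
(mapping `1 ↦ -2` and `2 ↦ -1`), and letters `i ≥ 1` are as in type `B`. -/
def sD : ℕ → Equiv.Perm ℤ
  | 0 => sB 0 * sB 1 * sB 0
  | (i+1) => sB (i+1)

def prodB (w : List ℕ) : Equiv.Perm ℤ := (w.map sB).prod
def prodD (w : List ℕ) : Equiv.Perm ℤ := (w.map sD).prod

/-- A word in the type `B`/`D` letters `{0, 1, …, n-1}`. -/
def IsWordBD (n : ℕ) (w : List ℕ) : Prop := ∀ i ∈ w, i ≤ n - 1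

/-- `w` is a reduced decomposition of `x ∈ S_n^B`. -/
def ReducedB (n : ℕ) (w : List ℕ) (x : Equiv.Perm ℤ) : Prop :=
  IsWordBD n w ∧ prodB w = x ∧
    ∀ w' : List ℕ, IsWordBD n w' → prodB w' = x → w.length ≤ w'.length

/-- `w` is a reduced decomposition of `x ∈ S_n^D`. -/
def ReducedD (n : ℕ) (w : List ℕ) (x : Equiv.Perm ℤ) : Prop :=
  IsWordBD n w ∧ prodD w = x ∧
    ∀ w' : List ℕ, IsWordBD n w' → prodD w' = x → w.length ≤ w'.length

/-- Length in `S_n^B`. -/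
noncomputable def lenB (n : ℕ) (x : Equiv.Perm ℤ) : ℕ :=
  sInf {l | ∃ w : List ℕ, IsWordBD n w ∧ prodB w = x ∧ w.length = l}

/-- Length in `S_n^D`. -/
noncomputable def lenD (n : ℕ) (x : Equiv.Perm ℤ) : ℕ :=
  sInf {l | ∃ w : List ℕ, IsWordBD n w ∧ prodD w = x ∧ w.length = l}

/-- Bruhat order on `S_n^B`. -/
def bruhatB (n : ℕ) (v w : Equiv.Perm ℤ) : Prop :=
  ∃ a b : List ℕ, ReducedB n a v ∧ ReducedB n b w ∧ a.Sublist b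

/-- Bruhat order on `S_n^D`. -/
def bruhatD (n : ℕ) (v w : Equiv.Perm ℤ) : Prop :=
  ∃ a b : List ℕ, ReducedD n a v ∧ ReducedD n b w ∧ a.Sublist b

/-- `w` is an element of `S_n^B`: an "odd" permutation of `{±1, …, ±n}`. -/
def IsSignedPerm (n : ℕ) (w : Equiv.Perm ℤ) : Prop :=
  (∀ x : ℤ, w (-x) = - w x) ∧ ∀ x : ℤ, (n : ℤ) < |x| → w x = x

/-- `w` is an element of `S_n^D`: a signed permutation with an even number of
negative values in its one-line notation. -/
def IsTypeD (n : ℕ) (w : Equiv.Perm ℤ) : Prop :=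
  IsSignedPerm n w ∧ Even (((Finset.Icc (1 : ℤ) n).filter (fun x => w x < 0)).card)

/-- `w ∈ S_n^B` is boolean (for the type `B` Bruhat order). -/
def BooleanB (n : ℕ) (w : Equiv.Perm ℤ) : Prop :=
  ∃ (r : ℕ) (e : {v : Equiv.Perm ℤ // bruhatB n v w} ≃ Finset (Fin r)),
    ∀ a b : {v : Equiv.Perm ℤ // bruhatB n v w}, bruhatB n a.1 b.1 ↔ e a ⊆ e b

/-- `w ∈ S_n^D` is boolean (for the type `D` Bruhat order). -/
def BooleanD (n : ℕ) (w : Equiv.Perm ℤ) : Prop :=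
  ∃ (r : ℕ) (e : {v : Equiv.Perm ℤ // bruhatD n v w} ≃ Finset (Fin r)),
    ∀ a b : {v : Equiv.Perm ℤ // bruhatD n v w}, bruhatD n a.1 b.1 ↔ e a ⊆ e b

/-- Signed pattern containment, where the pattern is given by its one-line
notation `p` (a list of nonzero integers): there are positions
`1 ≤ f 0 < ⋯ < f (k-1) ≤ n` such that each `w (f j)` has the same sign as the
`j`-th entry of `p`, and the absolute values appear in the same relative order. -/
def containsPat (n : ℕ) (w : Equiv.Perm ℤ) (p : List ℤ) : Prop :=
  ∃ f : Fin p.length → ℤ, StrictMono f ∧ (∀ j, 1 ≤ f j ∧ f j ≤ (n : ℤ)) ∧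
    (∀ j, 0 < w (f j) ↔ 0 < p.get j) ∧
    (∀ j j', |w (f j)| < |w (f j')| ↔ |p.get j| < |p.get j'|)

/-- Signed pattern avoidance. -/
def avoidsPat (n : ℕ) (w : Equiv.Perm ℤ) (p : List ℤ) : Prop := ¬ containsPat n w p


/-! ### Extra definitions used in some statements -/

/-- `w ∈ S_n` is decomposable: `B(w) ≅ B(u) × B(v)` (as posets under Bruhat order)
for some `u ∈ S_m`, `v ∈ S_{m'}` with `m, m' < n`. -/
def Decomposable (n : ℕ) (w : Equiv.Perm (Fin n)) : Prop :=
  ∃ (m m' : ℕ), m < n ∧ m' < n ∧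
    ∃ (u : Equiv.Perm (Fin m)) (v : Equiv.Perm (Fin m'))
      (e : {x : Equiv.Perm (Fin n) // bruhatA n x w} ≃
        {y : Equiv.Perm (Fin m) // bruhatA m y u} × {z : Equiv.Perm (Fin m') // bruhatA m' z v}),
      ∀ a b : {x : Equiv.Perm (Fin n) // bruhatA n x w},
        bruhatA n a.1 b.1 ↔
          (bruhatA m ((e a).1).1 ((e b).1).1 ∧ bruhatA m' ((e a).2).1 ((e b).2).1)

/-- `w` is decreasing on the set of positions `T`. -/
def DecrOn (n : ℕ) (w : Equiv.Perm (Fin n)) (T : Finset (Fin n)) : Prop :=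
  ∀ a ∈ T, ∀ b ∈ T, a < b → w b < w a

/-- Every inversion of `w` lies in exactly one occurrence of the decreasing
pattern `w_0^{(k)}`: for every `i < j` with `w i > w j` there is exactly one
`k`-element set of positions containing `i` and `j` on which `w` is decreasing. -/
def EveryInvOnce (n k : ℕ) (w : Equiv.Perm (Fin n)) : Prop :=
  ∀ i j : Fin n, i < j → w j < w i →
    ∃! T : Finset (Fin n), T.card = k ∧ DecrOn n w T ∧ i ∈ T ∧ j ∈ T

/-- Equality of two patterns of (possibly a priori different) sizes. -/
def EqPat {k m : ℕ} (p : Equiv.Perm (Fin k)) (q : Equiv.Perm (Fin m)) : Prop :=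
  ∃ h : k = m, ∀ i : Fin k, ((p i : ℕ) = (q (Fin.cast h i) : ℕ))

/-- `L(n,k)`: the number of boolean permutations in `S_n` of length `k`. -/
noncomputable def LA (n k : ℕ) : ℕ :=
  Nat.card {w : Equiv.Perm (Fin n) // BooleanA n w ∧ lenA n w = k}

/-- `L` extended to integer arguments, with the convention that it vanishes
when `m < 1` or `j < 0`. -/
noncomputable def Lz (m j : ℤ) : ℤ :=
  if 1 ≤ m ∧ 0 ≤ j then (LA m.toNat j.toNat : ℤ) else 0

/-- `L^D(n,k)`: the number of boolean elements of `S_n^D` of length `k`. -/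
noncomputable def LD (n k : ℕ) : ℕ :=
  Nat.card {w : Equiv.Perm ℤ // IsTypeD n w ∧ BooleanD n w ∧ lenD n w = k}

section
open Equiv

/-! ### Inversions -/

def invSet {n : ℕ} (w : Perm (Fin n)) : Finset (Fin n × Fin n) :=
  Finset.univ.filter (fun p => p.1 < p.2 ∧ w p.2 < w p.1)

def inv {n : ℕ} (w : Perm (Fin n)) : ℕ := (invSet w).card

lemma mem_invSet {n : ℕ} (w : Perm (Fin n)) (a b : Fin n) :
    (a, b) ∈ invSet w ↔ a < b ∧ w b < w a := by simp [invSet]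

lemma swap_val {n : ℕ} (P Q a : Fin n) :
    (swap P Q a).val = if a = P then Q.val else if a = Q then P.val else a.val := by
  rw [Equiv.swap_apply_def]; split_ifs <;> rfl

lemma inv_mul_swap {n : ℕ} (w : Perm (Fin n)) (P Q : Fin n) (h : P.val + 1 = Q.val)
    (hw : w P < w Q) : inv (w * swap P Q) = inv w + 1 := by
  have key : invSet (w * swap P Q) =
      insert (P, Q) ((invSet w).map ((swap P Q).prodCongr (swap P Q)).toEmbedding) := by
    ext ⟨a, b⟩
    rw [Finset.mem_insert, Finset.mem_map_equiv]
    rw [Equiv.prodCongr_symm, Equiv.symm_swap, Equiv.prodCongr_apply, Prod.map, mem_invSet,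
      mem_invSet, Perm.mul_apply, Perm.mul_apply, Prod.mk.injEq]
    have h1 := swap_val P Q a
    have h2 := swap_val P Q b
    by_cases e1 : a = P
    · by_cases e2 : b = Q
      · subst e1 e2
        have : a < b := by rw [Fin.lt_def]; omega
        simp [hw, this]
      · have : a < b ↔ swap P Q a < swap P Q b := by
          rw [Fin.lt_def, Fin.lt_def, h1, h2]; split_ifs <;> simp_all <;> omega
        rw [this]; simp [e2]
    · by_cases e2 : a = Q ∧ b = P
      · obtain ⟨rfl, rfl⟩ := e2
        rw [swap_apply_left, swap_apply_right]
        have h3 : ¬ a < b := by rw [Fin.lt_def]; omega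
        have h4 : ¬ w a < w b := hw.not_gt
        simp [h3, h4, e1]
      · have : a < b ↔ swap P Q a < swap P Q b := by
          have : a = P ↔ a.val = P.val := Fin.ext_iff
          have : a = Q ↔ a.val = Q.val := Fin.ext_iff
          have : b = P ↔ b.val = P.val := Fin.ext_iff
          have : b = Q ↔ b.val = Q.val := Fin.ext_iff
          rw [Fin.lt_def, Fin.lt_def, h1, h2]; split_ifs <;> omega
        rw [this]; simp [e1]
  rw [inv, key, Finset.card_insert_of_notMem, Finset.card_map, inv]
  rw [Finset.mem_map_equiv]
  rw [Equiv.prodCongr_symm, Equiv.symm_swap, Equiv.prodCongr_apply, Prod.map, mem_invSet,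
    swap_apply_left, swap_apply_right, Fin.lt_def]
  omega

lemma inv_mul_swap' {n : ℕ} (w : Perm (Fin n)) (P Q : Fin n) (h : P.val + 1 = Q.val)
    (hw : w Q < w P) : inv w = inv (w * swap P Q) + 1 := by
  have := inv_mul_swap (w * swap P Q) P Q h (by simpa using hw)
  simpa [mul_assoc] using this

lemma inv_one {n : ℕ} : inv (1 : Perm (Fin n)) = 0 := by
  simp only [inv, invSet, Finset.card_eq_zero, Finset.filter_eq_empty_iff]
  intro x _; simp; intro h; exact h.le

lemma exists_descent {n : ℕ} (w : Perm (Fin n)) (hw : w ≠ 1) :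
    ∃ P Q : Fin n, P.val + 1 = Q.val ∧ w Q < w P := by
  by_contra hc
  push Not at hc
  apply hw
  have hs : StrictMono w := by
    obtain _ | m := n
    · intro a; exact a.elim0
    · rw [Fin.strictMono_iff_lt_succ]
      intro i
      refine lt_of_le_of_ne (hc _ _ (by simp)) ?_
      simp [Fin.ext_iff]
  have := Subsingleton.elim (hs.orderIsoOfSurjective w w.surjective) (OrderIso.refl _)
  ext x
  have := congrArg (fun e => (e x).val) this
  simpa using this

lemma sA_eq {n : ℕ} (P Q : Fin n) (h : P.val + 1 = Q.val) : sA n Q.val = swap P Q := by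
  unfold sA
  rw [dif_pos ⟨by omega, Q.2⟩]
  congr 1
  apply Fin.ext; simp; omega

lemma letter {n i : ℕ} (h : 1 ≤ i ∧ i ≤ n - 1) :
    ∃ P Q : Fin n, P.val + 1 = Q.val ∧ Q.val = i :=
  ⟨⟨i - 1, by omega⟩, ⟨i, by omega⟩, by simp; omega, rfl⟩

lemma prodA_append {n : ℕ} (a b : List ℕ) : prodA n (a ++ b) = prodA n a * prodA n b := by
  simp [prodA]

lemma prodA_single {n : ℕ} (i : ℕ) : prodA n [i] = sA n i := by
  simp [prodA]

lemma inv_le_length {n : ℕ} (b : List ℕ) (hb : IsWordA n b) : inv (prodA n b) ≤ b.length := by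
  induction b using List.reverseRecOn with
  | nil => simp [prodA, inv_one]
  | append_singleton b i ih =>
    have h1 := ih (fun j hj => hb j (by simp [hj]))
    obtain ⟨P, Q, h, rfl⟩ := letter (hb i (by simp))
    rw [prodA_append, prodA_single, sA_eq P Q h, List.length_append, List.length_singleton]
    rcases lt_or_ge (prodA n b P) (prodA n b Q) with h2 | h2
    · rw [inv_mul_swap _ _ _ h h2]; omega
    · have h3 : prodA n b Q < prodA n b P := lt_of_le_of_ne h2 (by simp [Fin.ext_iff]; omega)
      have := inv_mul_swap' _ _ _ h h3
      omega

lemma exists_word {n : ℕ} (w : Perm (Fin n)) :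
    ∃ b, IsWordA n b ∧ prodA n b = w ∧ b.length = inv w := by
  induction hk : inv w generalizing w with
  | zero =>
    refine ⟨[], by simp [IsWordA], ?_, rfl⟩
    by_contra hne
    obtain ⟨P, Q, h, hd⟩ := exists_descent w (fun e => hne (by simp [prodA, e]))
    have := inv_mul_swap' _ _ _ h hd
    omega
  | succ k ih =>
    have hne : w ≠ 1 := by rintro rfl; simp [inv_one] at hk
    obtain ⟨P, Q, h, hd⟩ := exists_descent w hne
    have := inv_mul_swap' _ _ _ h hd
    obtain ⟨b, h1, h2, h3⟩ := ih (w * swap P Q) (by omega)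
    refine ⟨b ++ [Q.val], ?_, ?_, by simp [h3]⟩
    · intro i hi
      rw [List.mem_append] at hi
      rcases hi with hi | hi
      · exact h1 i hi
      · simp at hi; omega
    · rw [prodA_append, prodA_single, sA_eq P Q h, h2]; simp [mul_assoc]

lemma reduced_iff {n : ℕ} (b : List ℕ) (x : Perm (Fin n)) :
    ReducedA n b x ↔ IsWordA n b ∧ prodA n b = x ∧ b.length = inv x := by
  constructor
  · rintro ⟨h1, h2, h3⟩
    obtain ⟨c, c1, c2, c3⟩ := exists_word x
    have := h3 c c1 c2
    have := inv_le_length b h1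
    rw [h2] at this
    exact ⟨h1, h2, by omega⟩
  · rintro ⟨h1, h2, h3⟩
    refine ⟨h1, h2, fun c c1 c2 => ?_⟩
    have := inv_le_length c c1
    rw [c2] at this; omega

lemma lenA_eq {n : ℕ} (x : Perm (Fin n)) : lenA n x = inv x := by
  unfold lenA
  apply le_antisymm
  · exact Nat.sInf_le (exists_word x)
  · have hne : {l | ∃ w : List ℕ, IsWordA n w ∧ prodA n w = x ∧ w.length = l}.Nonempty :=
      ⟨_, exists_word x⟩
    obtain ⟨b, h1, h2, h3⟩ := Nat.sInf_mem hne
    have := inv_le_length b h1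
    rw [h2] at this
    omega

/-! ### Rank functions -/

def rk {n : ℕ} (w : Perm (Fin n)) (i j : ℕ) : ℕ :=
  (Finset.univ.filter (fun a : Fin n => a.val < i ∧ j ≤ (w a).val)).card

def le {n : ℕ} (v w : Perm (Fin n)) : Prop := ∀ i j, rk v i j ≤ rk w i j

lemma mem_rk {n : ℕ} (w : Perm (Fin n)) (i j : ℕ) (a : Fin n) :
    a ∈ (Finset.univ.filter (fun a : Fin n => a.val < i ∧ j ≤ (w a).val)) ↔
      a.val < i ∧ j ≤ (w a).val := by simp

lemma le_trans' {n : ℕ} {u v w : Perm (Fin n)} (h1 : le u v) (h2 : le v w) : le u w :=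
  fun i j => (h1 i j).trans (h2 i j)

lemma rk_succ {n : ℕ} (w : Perm (Fin n)) (P : Fin n) (j : ℕ) :
    rk w (P.val + 1) j = rk w P.val j + if j ≤ (w P).val then 1 else 0 := by
  unfold rk
  split_ifs with h
  · have : (Finset.univ.filter (fun a : Fin n => a.val < P.val + 1 ∧ j ≤ (w a).val)) =
      insert P (Finset.univ.filter (fun a : Fin n => a.val < P.val ∧ j ≤ (w a).val)) := by
      ext a; simp only [Finset.mem_filter, Finset.mem_univ, true_and, Finset.mem_insert]
      constructor
      · rintro ⟨h1, h2⟩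
        by_cases e : a = P
        · exact Or.inl e
        · exact Or.inr ⟨by rw [Fin.ext_iff] at e; omega, h2⟩
      · rintro (rfl | ⟨h1, h2⟩)
        · exact ⟨by omega, h⟩
        · exact ⟨by omega, h2⟩
    rw [this, Finset.card_insert_of_notMem (by simp)]
  · simp only [add_zero]
    refine congrArg Finset.card ?_
    ext a; simp only [Finset.mem_filter, Finset.mem_univ, true_and]
    constructor
    · rintro ⟨h1, h2⟩
      have e : a ≠ P := by rintro rfl; exact h h2
      exact ⟨by rw [Ne, Fin.ext_iff] at e; omega, h2⟩
    · rintro ⟨h1, h2⟩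
      exact ⟨by omega, h2⟩

lemma rk_swap_ne {n : ℕ} (w : Perm (Fin n)) (P Q : Fin n) (h : P.val + 1 = Q.val) (i j : ℕ)
    (hi : i ≠ Q.val) : rk (w * swap P Q) i j = rk w i j := by
  unfold rk
  rw [← Finset.card_map (swap P Q).toEmbedding]
  congr 1
  ext a
  rw [Finset.mem_map_equiv]
  rw [mem_rk, mem_rk, Equiv.symm_swap, Perm.mul_apply, swap_apply_self]
  have h1 := swap_val P Q a
  have e1 : a = P ↔ a.val = P.val := Fin.ext_iff
  have e2 : a = Q ↔ a.val = Q.val := Fin.ext_iff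
  rw [h1]
  split_ifs <;> simp_all <;> omega

lemma rk_swap_eq {n : ℕ} (w : Perm (Fin n)) (P Q : Fin n) (h : P.val + 1 = Q.val) (j : ℕ) :
    rk (w * swap P Q) Q.val j = rk w P.val j + if j ≤ (w Q).val then 1 else 0 := by
  rw [← h, rk_succ, rk_swap_ne w P Q h _ _ (by omega)]
  simp

lemma rk_le_two {n : ℕ} (w : Perm (Fin n)) (P Q : Fin n) (h : P.val + 1 = Q.val) (j : ℕ) :
    rk w Q.val j = rk w P.val j + (if j ≤ (w P).val then 1 else 0) ∧
    rk w (Q.val + 1) j = rk w Q.val j + (if j ≤ (w Q).val then 1 else 0) := by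
  refine ⟨?_, rk_succ w Q j⟩
  rw [← h]; exact rk_succ w P j

lemma le_swap {n : ℕ} (w : Perm (Fin n)) (P Q : Fin n) (h : P.val + 1 = Q.val)
    (hw : w P < w Q) : le w (w * swap P Q) := by
  intro i j
  by_cases hi : i = Q.val
  · subst hi
    rw [rk_swap_eq w P Q h, (rk_le_two w P Q h j).1]
    rw [Fin.lt_def] at hw
    split_ifs <;> omega
  · rw [rk_swap_ne w P Q h _ _ hi]

/-- lifting -/
lemma lift_le {n : ℕ} (v w : Perm (Fin n)) (P Q : Fin n) (h : P.val + 1 = Q.val)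
    (hv : v P < v Q) (hw : w P < w Q) (hle : le v (w * swap P Q)) : le v w := by
  intro i j
  by_cases hi : i = Q.val
  · subst hi
    have a1 := hle P.val j
    have a2 := hle (Q.val + 1) j
    rw [rk_swap_ne w P Q h _ _ (by omega)] at a1 a2
    have b := rk_le_two w P Q h j
    have c := rk_le_two v P Q h j
    rw [Fin.lt_def] at hw hv
    split_ifs at b c <;> omega
  · have := hle i j
    rwa [rk_swap_ne w P Q h _ _ hi] at this

lemma mul_le_mul {n : ℕ} (v w : Perm (Fin n)) (P Q : Fin n) (h : P.val + 1 = Q.val)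
    (hw : w P < w Q) (hle : le v w) : le (v * swap P Q) (w * swap P Q) := by
  rcases lt_or_ge (v P) (v Q) with hv | hv
  · intro i j
    by_cases hi : i = Q.val
    · subst hi
      have a1 := hle P.val j
      have a2 := hle (Q.val + 1) j
      rw [rk_swap_eq w P Q h, rk_swap_eq v P Q h]
      have b := rk_le_two w P Q h j
      have c := rk_le_two v P Q h j
      rw [Fin.lt_def] at hw hv
      split_ifs at b c ⊢ <;> omega
    · rw [rk_swap_ne w P Q h _ _ hi, rk_swap_ne v P Q h _ _ hi]; exact hle i j
  · have h3 : v Q < v P := lt_of_le_of_ne hv (by simp [Fin.ext_iff]; omega)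
    have h4 := le_swap (v * swap P Q) P Q h (by simpa using h3)
    rw [mul_assoc, swap_mul_self, mul_one] at h4
    exact le_trans' h4 (le_trans' hle (le_swap w P Q h hw))

lemma le_mul_swap_iff {n : ℕ} (v w : Perm (Fin n)) (P Q : Fin n) (h : P.val + 1 = Q.val)
    (hw : w P < w Q) : le v (w * swap P Q) ↔ le v w ∨ le (v * swap P Q) w := by
  constructor
  · intro hle
    rcases lt_or_ge (v P) (v Q) with hv | hv
    · exact Or.inl (lift_le v w P Q h hv hw hle)
    · have h3 : v Q < v P := lt_of_le_of_ne hv (by simp [Fin.ext_iff]; omega)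
      have h4 := le_swap (v * swap P Q) P Q h (by simpa using h3)
      rw [mul_assoc, swap_mul_self, mul_one] at h4
      exact Or.inr (lift_le _ w P Q h (by simpa using h3) hw (le_trans' h4 hle))
  · rintro (h1 | h1)
    · exact le_trans' h1 (le_swap w P Q h hw)
    · have := mul_le_mul _ _ P Q h hw h1
      rwa [mul_assoc, swap_mul_self, mul_one] at this

lemma le_one {n : ℕ} (v : Perm (Fin n)) (h : le v 1) : v = 1 := by
  by_contra hne
  obtain ⟨P, Q, hPQ, hd⟩ := exists_descent v hne
  have h0 : ∀ i : ℕ, rk (1 : Perm (Fin n)) i i = 0 := by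
    intro i
    simp only [rk, Finset.card_eq_zero, Finset.filter_eq_empty_iff]
    intro x _; simp
  have h1 : ∀ a : Fin n, v a ≤ a := by
    intro a
    by_contra hlt
    have := h (a.val + 1) (a.val + 1)
    rw [h0] at this
    simp only [rk, Nat.le_zero, Finset.card_eq_zero, Finset.filter_eq_empty_iff] at this
    apply this (Finset.mem_univ a)
    simp only [not_le, Fin.lt_def] at hlt
    omega
  apply hne
  ext a
  simp only [Perm.coe_one, id_eq]
  induction hk : a.val using Nat.strong_induction_on generalizing a with
  | _ k ih =>
    have h2 := h1 a
    rw [Fin.le_def] at h2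
    by_contra hlt
    have h3 := ih (v a).val (by omega) (v a) rfl
    have h4 : v (v a) = v a := Fin.ext h3
    have := v.injective h4
    rw [this] at hlt; omega

lemma bruhat_iff {n : ℕ} (v w : Perm (Fin n)) : bruhatA n v w ↔ le v w := by
  constructor
  · rintro ⟨a, b, ha, hb, hab⟩
    rw [reduced_iff] at ha hb
    obtain ⟨-, rfl, -⟩ := ha
    obtain ⟨hb1, rfl, hb2⟩ := hb
    induction b using List.reverseRecOn generalizing a with
    | nil => rw [List.sublist_nil.1 hab]; exact fun i j => le_rfl
    | append_singleton b i ih =>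
      have hw : IsWordA n b := fun j hj => hb1 j (by simp [hj])
      have hl := inv_le_length b hw
      obtain ⟨P, Q, h, rfl⟩ := letter (hb1 i (by simp))
      rw [prodA_append, prodA_single, sA_eq P Q h, List.length_append, List.length_singleton]
        at hb2
      rw [prodA_append, prodA_single, sA_eq P Q h]
      have hlt : prodA n b P < prodA n b Q := by
        by_contra h2
        have h3 : prodA n b Q < prodA n b P :=
          lt_of_le_of_ne (not_lt.1 h2) (by simp [Fin.ext_iff]; omega)
        have := inv_mul_swap' _ _ _ h h3
        omega
      have e := inv_mul_swap _ _ _ h hlt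
      obtain ⟨a1, a2, rfl, s1, s2⟩ := List.sublist_append_iff.1 hab
      have ih' := ih a1 s1 hw (by omega)
      rw [le_mul_swap_iff _ _ _ _ h hlt]
      rcases List.sublist_singleton.1 s2 with rfl | rfl
      · left; simpa using ih'
      · right
        rw [prodA_append, prodA_single, sA_eq P Q h, mul_assoc, swap_mul_self, mul_one]
        exact ih'
  · intro hle
    induction hk : inv w generalizing v w with
    | zero =>
      have : w = 1 := by
        by_contra hne
        obtain ⟨P, Q, h, hd⟩ := exists_descent w hne
        have := inv_mul_swap' _ _ _ h hd
        omega
      subst this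
      rw [le_one v hle]
      have : ReducedA n [] 1 := ⟨by simp [IsWordA], by simp [prodA], by simp⟩
      exact ⟨[], [], this, this, List.Sublist.refl _⟩
    | succ k ih =>
      have hne : w ≠ 1 := by rintro rfl; simp [inv_one] at hk
      obtain ⟨P, Q, h, hd⟩ := exists_descent w hne
      have hi := inv_mul_swap' _ _ _ h hd
      have hww : w = (w * swap P Q) * swap P Q := by simp [mul_assoc]
      have hd' : (w * swap P Q) P < (w * swap P Q) Q := by simpa using hd
      have red : ∀ (b : List ℕ) (u : Perm (Fin n)), u Q < u P → ReducedA n b (u * swap P Q) →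
          ReducedA n (b ++ [Q.val]) u := by
        intro b u hu hb
        rw [reduced_iff] at hb ⊢
        obtain ⟨b1, b2, b3⟩ := hb
        refine ⟨?_, ?_, ?_⟩
        · intro i hi
          rw [List.mem_append] at hi
          rcases hi with hi | hi
          · exact b1 i hi
          · simp at hi; omega
        · rw [prodA_append, prodA_single, sA_eq P Q h, b2]; simp [mul_assoc]
        · have := inv_mul_swap' _ _ _ h hu
          simp; omega
      rcases lt_or_ge (v P) (v Q) with hv | hv
      · have h1 := lift_le v (w * swap P Q) P Q h hv hd' (by rw [← hww]; exact hle)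
        obtain ⟨a, b, ha, hb, hab⟩ := ih _ _ h1 (by omega)
        exact ⟨a, b ++ [Q.val], ha, red b w hd hb, hab.trans (List.sublist_append_left _ _)⟩
      · have h3 : v Q < v P := lt_of_le_of_ne hv (by simp [Fin.ext_iff]; omega)
        have h4 := le_swap (v * swap P Q) P Q h (by simpa using h3)
        rw [mul_assoc, swap_mul_self, mul_one] at h4
        have h1 := lift_le (v * swap P Q) (w * swap P Q) P Q h (by simpa using h3) hd'
          (by rw [← hww]; exact le_trans' h4 hle)
        obtain ⟨a, b, ha, hb, hab⟩ := ih _ _ h1 (by omega)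
        exact ⟨a ++ [Q.val], b ++ [Q.val], red a v h3 ha, red b w hd hb,
          hab.append (List.Sublist.refl _)⟩

/-! ### Inverses -/

lemma prodA_reverse {n : ℕ} (b : List ℕ) : prodA n b.reverse = (prodA n b)⁻¹ := by
  induction b with
  | nil => simp [prodA]
  | cons i b ih =>
    have : (sA n i)⁻¹ = sA n i := by
      unfold sA; split_ifs <;> simp
    rw [List.reverse_cons, prodA_append, ih, prodA_single, ← this]
    simp [prodA]

lemma inv_inv {n : ℕ} (w : Perm (Fin n)) : inv w⁻¹ = inv w := by
  have : ∀ w : Perm (Fin n), inv w⁻¹ ≤ inv w := by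
    intro w
    obtain ⟨b, h1, h2, h3⟩ := exists_word w
    have := inv_le_length b.reverse (fun i hi => h1 i (by simpa using hi))
    rw [prodA_reverse, h2, List.length_reverse] at this
    omega
  apply le_antisymm (this w)
  simpa using this w⁻¹

lemma le_inv {n : ℕ} (v w : Perm (Fin n)) : le v⁻¹ w⁻¹ ↔ le v w := by
  have : ∀ v w : Perm (Fin n), le v w → le v⁻¹ w⁻¹ := by
    intro v w h
    rw [← bruhat_iff] at h ⊢
    obtain ⟨a, b, ha, hb, hab⟩ := h
    have key : ∀ (a : List ℕ) (v : Perm (Fin n)), ReducedA n a v → ReducedA n a.reverse v⁻¹ := by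
      intro a v h
      rw [reduced_iff] at h ⊢
      refine ⟨fun i hi => h.1 i (by simpa using hi), by rw [prodA_reverse, h.2.1], ?_⟩
      rw [inv_inv, List.length_reverse, h.2.2]
    exact ⟨_, _, key _ _ ha, key _ _ hb, List.reverse_sublist.2 hab⟩
  constructor
  · intro h; simpa using this _ _ h
  · exact this v w

/-- `w` fixes everything `≥ M`. -/
def FixGe {n : ℕ} (M : ℕ) (w : Perm (Fin n)) : Prop := ∀ i : Fin n, M ≤ i.val → w i = i

lemma FixGe.inv {n M : ℕ} {w : Perm (Fin n)} (h : FixGe M w) : FixGe M w⁻¹ := by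
  intro i hi
  rw [Perm.inv_eq_iff_eq]; exact (h i hi).symm

lemma FixGe.lt {n M : ℕ} {w : Perm (Fin n)} (h : FixGe M w) {a : Fin n} (ha : a.val < M) :
    (w a).val < M := by
  by_contra hc
  have := w.injective (h (w a) (by omega))
  rw [this] at hc; omega

lemma fix_le {n M : ℕ} {v w : Perm (Fin n)} (h : le v w) (hw : FixGe M w) : FixGe M v := by
  have key : ∀ v w : Perm (Fin n), le v w → FixGe M w →
      ∀ k, M ≤ k → ∀ a : Fin n, a.val < k → (v a).val < k := by
    intro v w h hw k hk a ha
    have h0 : rk w k k = 0 := by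
      simp only [rk, Finset.card_eq_zero, Finset.filter_eq_empty_iff]
      rintro x - ⟨h1, h2⟩
      rcases lt_or_ge x.val M with h3 | h3
      · have := hw.lt h3; omega
      · rw [hw x h3] at h2; omega
    by_contra hc
    have := h k k
    rw [h0] at this
    simp only [rk, Nat.le_zero, Finset.card_eq_zero, Finset.filter_eq_empty_iff] at this
    exact this (Finset.mem_univ a) ⟨ha, by omega⟩
  intro i hi
  have h1 := key v w h hw (i.val + 1) (by omega) i (by omega)
  have h2 := key v⁻¹ w⁻¹ ((le_inv v w).2 h) hw.inv (i.val + 1) (by omega) i (by omega)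
  by_contra hne
  have h3 : (v⁻¹ i).val ≠ i.val := by
    intro e
    apply hne
    have : v⁻¹ i = i := Fin.ext e
    rw [Perm.inv_eq_iff_eq] at this; exact this.symm
  have h4 := key v w h hw i.val hi (v⁻¹ i) (by omega)
  simp at h4

end

section
open Equiv

/-! ### Order ideals -/

open Classical in
noncomputable def B {n : ℕ} (w : Perm (Fin n)) : Finset (Perm (Fin n)) :=
  Finset.univ.filter (fun v => le v w)

lemma mem_B {n : ℕ} (v w : Perm (Fin n)) : v ∈ B w ↔ le v w := by simp [B]

lemma card_B {n : ℕ} (w : Perm (Fin n)) :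
    Nat.card {v : Perm (Fin n) // bruhatA n v w} = (B w).card := by
  classical
  rw [Nat.card_eq_fintype_card]
  apply Fintype.card_of_subtype
  intro v; rw [mem_B, bruhat_iff]

lemma B_one {n : ℕ} : B (1 : Perm (Fin n)) = {1} := by
  ext v; rw [mem_B, Finset.mem_singleton]
  exact ⟨le_one v, by rintro rfl; exact fun _ _ => le_rfl⟩

/-- recursion, right multiplication -/
lemma mem_B_right {n : ℕ} (v w : Perm (Fin n)) (P Q : Fin n) (h : P.val + 1 = Q.val)
    (hw : w P < w Q) : v ∈ B (w * swap P Q) ↔ v ∈ B w ∨ v * swap P Q ∈ B w := by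
  simp only [mem_B]; exact le_mul_swap_iff v w P Q h hw

lemma mem_B_inv {n : ℕ} (v w : Perm (Fin n)) : v⁻¹ ∈ B w⁻¹ ↔ v ∈ B w := by
  simp only [mem_B]; exact le_inv v w

lemma card_B_inv {n : ℕ} (w : Perm (Fin n)) : (B w⁻¹).card = (B w).card := by
  rw [← Finset.card_map (Equiv.inv (Perm (Fin n))).toEmbedding]
  congr 1
  ext v
  rw [Finset.mem_map_equiv]
  simpa using mem_B_inv v w

lemma mem_B_left {n : ℕ} (v w : Perm (Fin n)) (P Q : Fin n) (h : P.val + 1 = Q.val)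
    (hw : w⁻¹ P < w⁻¹ Q) : v ∈ B (swap P Q * w) ↔ v ∈ B w ∨ swap P Q * v ∈ B w := by
  have := mem_B_right v⁻¹ w⁻¹ P Q h hw
  have e1 : w⁻¹ * swap P Q = (swap P Q * w)⁻¹ := by simp
  have e2 : v⁻¹ * swap P Q = (swap P Q * v)⁻¹ := by simp
  rw [e1, e2, mem_B_inv, mem_B_inv, mem_B_inv] at this
  exact this

lemma inv_left {n : ℕ} (w : Perm (Fin n)) (P Q : Fin n) (h : P.val + 1 = Q.val)
    (hw : w⁻¹ P < w⁻¹ Q) : inv (swap P Q * w) = inv w + 1 := by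
  have := inv_mul_swap w⁻¹ P Q h hw
  have e1 : w⁻¹ * swap P Q = (swap P Q * w)⁻¹ := by simp
  rw [e1, inv_inv, inv_inv] at this
  exact this

/-! ### Patterns -/

def A321 {n : ℕ} (w : Perm (Fin n)) : Prop :=
  ∀ a b c : Fin n, a < b → b < c → w c < w b → w b < w a → False

def Occ {n : ℕ} (w : Perm (Fin n)) (a b c d : Fin n) : Prop :=
  a < b ∧ b < c ∧ c < d ∧ w c < w d ∧ w d < w a ∧ w a < w b

def A3412 {n : ℕ} (w : Perm (Fin n)) : Prop := ∀ a b c d, ¬ Occ w a b c d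

def U3412 {n : ℕ} (w : Perm (Fin n)) : Prop :=
  ∃ a b c d, Occ w a b c d ∧
    ∀ a' b' c' d', Occ w a' b' c' d' → a' = a ∧ b' = b ∧ c' = c ∧ d' = d

lemma A321.inv {n : ℕ} {w : Perm (Fin n)} (h : A321 w) : A321 w⁻¹ := by
  intro a b c h1 h2 h3 h4
  exact h (w⁻¹ c) (w⁻¹ b) (w⁻¹ a) h3 h4 (by simpa using h1) (by simpa using h2)

lemma Occ.inv {n : ℕ} {w : Perm (Fin n)} {a b c d : Fin n} (h : Occ w a b c d) :
    Occ w⁻¹ (w c) (w d) (w a) (w b) := by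
  obtain ⟨h1, h2, h3, h4, h5, h6⟩ := h
  refine ⟨h4, h5, h6, ?_, ?_, ?_⟩ <;> simpa

lemma A3412.inv {n : ℕ} {w : Perm (Fin n)} (h : A3412 w) : A3412 w⁻¹ := by
  intro a b c d h1
  have := h1.inv
  rw [_root_.inv_inv] at this
  exact h _ _ _ _ this

lemma U3412.inv {n : ℕ} {w : Perm (Fin n)} (h : U3412 w) : U3412 w⁻¹ := by
  obtain ⟨a, b, c, d, h1, h2⟩ := h
  refine ⟨_, _, _, _, h1.inv, ?_⟩
  intro a' b' c' d' h3
  have := h3.inv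
  rw [_root_.inv_inv] at this
  obtain ⟨rfl, rfl, rfl, rfl⟩ := h2 _ _ _ _ this
  simp

lemma inversion_lt {n M : ℕ} {w : Perm (Fin n)} (hw : FixGe M w) {a b : Fin n} (h : a < b)
    (h' : w b < w a) : a.val < M ∧ b.val < M := by
  rw [Fin.lt_def] at h h'
  have hb : b.val < M := by
    by_contra hc
    rw [hw b (by omega)] at h'
    rcases lt_or_ge a.val M with h3 | h3
    · have := hw.lt h3; omega
    · rw [hw a h3] at h'; omega
  omega

lemma Occ.lt {n M : ℕ} {w : Perm (Fin n)} (hw : FixGe M w) {a b c d : Fin n}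
    (h : Occ w a b c d) : a.val < M ∧ b.val < M ∧ c.val < M ∧ d.val < M := by
  obtain ⟨h1, h2, h3, h4, h5, h6⟩ := h
  have := inversion_lt hw (h1.trans (h2.trans h3)) h5
  have := inversion_lt hw h2 (h4.trans (h5.trans h6))
  tauto

/-- pattern transfer -/
lemma transfer321 {n M : ℕ} {w w' : Perm (Fin n)} (hw' : FixGe M w') (f g : Fin n → Fin n)
    (hf : ∀ a b : Fin n, a.val < M → b.val < M → a < b → f a < f b)
    (hg : ∀ a b : Fin n, a.val < M → b.val < M → a < b → g a < g b)
    (hfg : ∀ a : Fin n, a.val < M → w (f a) = g (w' a)) (h : A321 w) : A321 w' := by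
  intro a b c h1 h2 h3 h4
  obtain ⟨l1, l2⟩ := inversion_lt hw' h1 h4
  obtain ⟨_, l3⟩ := inversion_lt hw' h2 h3
  refine h (f a) (f b) (f c) (hf _ _ l1 l2 h1) (hf _ _ l2 l3 h2) ?_ ?_
  · rw [hfg _ l2, hfg _ l3]; exact hg _ _ (hw'.lt l3) (hw'.lt l2) h3
  · rw [hfg _ l2, hfg _ l1]; exact hg _ _ (hw'.lt l2) (hw'.lt l1) h4

lemma transfer3412 {n M : ℕ} {w w' : Perm (Fin n)} (hw' : FixGe M w') (f g : Fin n → Fin n)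
    (hf : ∀ a b : Fin n, a.val < M → b.val < M → a < b → f a < f b)
    (hg : ∀ a b : Fin n, a.val < M → b.val < M → a < b → g a < g b)
    (hfg : ∀ a : Fin n, a.val < M → w (f a) = g (w' a)) {a b c d : Fin n} (h : Occ w' a b c d) :
    Occ w (f a) (f b) (f c) (f d) := by
  obtain ⟨l1, l2, l3, l4⟩ := h.lt hw'
  obtain ⟨h1, h2, h3, h4, h5, h6⟩ := h
  refine ⟨hf _ _ l1 l2 h1, hf _ _ l2 l3 h2, hf _ _ l3 l4 h3, ?_, ?_, ?_⟩
  · rw [hfg _ l3, hfg _ l4]; exact hg _ _ (hw'.lt l3) (hw'.lt l4) h4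
  · rw [hfg _ l4, hfg _ l1]; exact hg _ _ (hw'.lt l4) (hw'.lt l1) h5
  · rw [hfg _ l1, hfg _ l2]; exact hg _ _ (hw'.lt l1) (hw'.lt l2) h6

/-! ### The reduction step -/

section Step
variable {n : ℕ} {w : Perm (Fin n)} {P Q : Fin n}

lemma step_fix (h : P.val + 1 = Q.val) (hw : FixGe (Q.val + 1) w) (hp : w P = Q) :
    FixGe Q.val (w * swap P Q) := by
  intro i hi
  rw [Perm.mul_apply]
  by_cases e : i = Q
  · rw [e, swap_apply_right, hp]
  · have e' : i.val ≠ Q.val := fun h => e (Fin.ext h)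
    rw [swap_apply_of_ne_of_ne _ e]
    · exact hw i (by omega)
    · rw [Ne, Fin.ext_iff]; omega

lemma swap_mono (h : P.val + 1 = Q.val) (a b : Fin n) (ha : a.val < Q.val) (hb : b.val < Q.val)
    (hab : a < b) : swap P Q a < swap P Q b := by
  have h1 := swap_val P Q a
  have h2 := swap_val P Q b
  have : a = P ↔ a.val = P.val := Fin.ext_iff
  have : a = Q ↔ a.val = Q.val := Fin.ext_iff
  have : b = P ↔ b.val = P.val := Fin.ext_iff
  have : b = Q ↔ b.val = Q.val := Fin.ext_iff
  rw [Fin.lt_def] at hab ⊢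
  rw [h1, h2]; split_ifs <;> omega

lemma step_321 (h : P.val + 1 = Q.val) (hw : FixGe (Q.val + 1) w) (hp : w P = Q)
    (hA : A321 w) : A321 (w * swap P Q) :=
  transfer321 (step_fix h hw hp) (swap P Q) id (swap_mono h) (fun _ _ _ _ h => h)
    (fun _ _ => rfl) hA

lemma step_occ (h : P.val + 1 = Q.val) (hw : FixGe (Q.val + 1) w) (hp : w P = Q)
    {a b c d : Fin n} (ho : Occ (w * swap P Q) a b c d) :
    Occ w (swap P Q a) (swap P Q b) (swap P Q c) (swap P Q d) :=
  transfer3412 (step_fix h hw hp) (swap P Q) id (swap_mono h) (fun _ _ _ _ h => h)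
    (fun _ _ => rfl) ho

lemma step_3412 (h : P.val + 1 = Q.val) (hw : FixGe (Q.val + 1) w) (hp : w P = Q)
    (hA : A3412 w) : A3412 (w * swap P Q) :=
  fun _ _ _ _ ho => hA _ _ _ _ (step_occ h hw hp ho)

lemma step_U (h : P.val + 1 = Q.val) (hw : FixGe (Q.val + 1) w) (hp : w P = Q)
    (hU : U3412 w) : U3412 (w * swap P Q) := by
  obtain ⟨a, b, c, d, ho, hu⟩ := hU
  refine ⟨swap P Q a, swap P Q b, swap P Q c, swap P Q d, ?_, ?_⟩
  · obtain ⟨l1, l2, l3, l4⟩ := ho.lt hw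
    obtain ⟨h1, h2, h3, h4, h5, h6⟩ := ho
    have hmax : ∀ x : Fin n, x.val < Q.val + 1 → ¬ w P < w x := by
      intro x hx hlt
      have := hw.lt hx
      rw [hp, Fin.lt_def] at hlt; omega
    have na : a ≠ P := by rintro rfl; exact hmax _ l2 h6
    have nc : c ≠ P := by rintro rfl; exact hmax _ l4 h4
    have nd : d ≠ P := by rintro rfl; exact hmax _ l1 h5
    have nb : b ≠ P := by
      rintro rfl
      rw [Fin.lt_def] at h2 h3; omega
    have mono : ∀ x y : Fin n, x ≠ P → y ≠ P → x.val < Q.val + 1 → y.val < Q.val + 1 → x < y →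
        swap P Q x < swap P Q y := by
      intro a b na nb la lb hab
      have h1 := swap_val P Q a
      have h2 := swap_val P Q b
      have : a = P ↔ a.val = P.val := Fin.ext_iff
      have : a = Q ↔ a.val = Q.val := Fin.ext_iff
      have : b = P ↔ b.val = P.val := Fin.ext_iff
      have : b = Q ↔ b.val = Q.val := Fin.ext_iff
      rw [Fin.lt_def] at hab ⊢
      rw [h1, h2]; split_ifs <;> omega
    refine ⟨mono _ _ na nb l1 l2 h1, mono _ _ nb nc l2 l3 h2, mono _ _ nc nd l3 l4 h3, ?_, ?_, ?_⟩
      <;> simpa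
  · intro a' b' c' d' ho'
    obtain ⟨rfl, rfl, rfl, rfl⟩ := hu _ _ _ _ (step_occ h hw hp ho')
    simp

lemma step_lt (h : P.val + 1 = Q.val) (hw : FixGe (Q.val + 1) w) (hp : w P = Q) :
    (w * swap P Q) P < (w * swap P Q) Q := by
  rw [Perm.mul_apply, Perm.mul_apply, swap_apply_left, swap_apply_right, hp]
  refine lt_of_le_of_ne ?_ ?_
  · have := hw.lt (a := Q) (by omega)
    rw [Fin.le_def]; omega
  · rw [← hp]; simp [Fin.ext_iff]; omega

lemma step_inv (h : P.val + 1 = Q.val) (hw : FixGe (Q.val + 1) w) (hp : w P = Q) :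
    inv w = inv (w * swap P Q) + 1 := by
  have := inv_mul_swap _ P Q h (step_lt h hw hp)
  simpa [mul_assoc] using this

lemma step_mem (h : P.val + 1 = Q.val) (hw : FixGe (Q.val + 1) w) (hp : w P = Q)
    (v : Perm (Fin n)) : v ∈ B w ↔ v ∈ B (w * swap P Q) ∨ v * swap P Q ∈ B (w * swap P Q) := by
  rw [← mem_B_right v (w * swap P Q) P Q h (step_lt h hw hp)]
  simp [mul_assoc]

open Classical in
lemma card_double (X Y : Finset (Perm (Fin n))) (s : Perm (Fin n)) (hs : s * s = 1)
    (h : ∀ v, v ∈ Y ↔ v ∈ X ∨ v * s ∈ X) (hd : ∀ v ∈ X, v * s ∉ X) : Y.card = 2 * X.card := by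
  have : Y = X ∪ X.map (Equiv.mulRight s).toEmbedding := by
    ext v
    rw [h, Finset.mem_union, Finset.mem_map_equiv]
    have : s⁻¹ = s := by rw [inv_eq_iff_mul_eq_one, hs]
    simp [this]
  rw [this, Finset.card_union_of_disjoint, Finset.card_map]
  · ring
  · rw [Finset.disjoint_left]
    intro v hv hv'
    rw [Finset.mem_map_equiv] at hv'
    have : s⁻¹ = s := by rw [inv_eq_iff_mul_eq_one, hs]
    simp [this] at hv'
    exact hd v hv hv'

lemma not_mem_of_fix {X : Finset (Perm (Fin n))} (h : P.val + 1 = Q.val)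
    (hX : ∀ v ∈ X, v Q = Q) : ∀ v ∈ X, v * swap P Q ∉ X := by
  intro v hv hv'
  have h1 := hX _ hv'
  rw [Perm.mul_apply, swap_apply_right] at h1
  have h2 := hX _ hv
  rw [← h1] at h2
  have := v.injective h2
  rw [h1] at h2
  have h3 := v.injective (h1.trans (hX _ hv).symm)
  rw [h3] at h; omega

lemma B_fix {M : ℕ} (hw : FixGe M w) : ∀ v ∈ B w, FixGe M v :=
  fun v hv => fix_le ((mem_B v w).1 hv) hw

lemma step_card (h : P.val + 1 = Q.val) (hw : FixGe (Q.val + 1) w) (hp : w P = Q) :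
    (B w).card = 2 * (B (w * swap P Q)).card := by
  apply card_double _ _ (swap P Q) (by simp) (step_mem h hw hp)
  exact not_mem_of_fix h (fun v hv => B_fix (step_fix h hw hp) v hv Q le_rfl)

lemma step_half (h : P.val + 1 = Q.val) (hw : FixGe (Q.val + 1) w) (hp : w P = Q) :
    (B w).card = 2 * ((B w).filter (fun v => v Q = Q)).card := by
  rw [step_card h hw hp]
  congr 2
  ext v
  rw [Finset.mem_filter, step_mem h hw hp v]
  have hf : ∀ v ∈ B (w * swap P Q), v Q = Q :=
    fun v hv => B_fix (step_fix h hw hp) v hv Q le_rfl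
  constructor
  · intro hv; exact ⟨Or.inl hv, hf v hv⟩
  · rintro ⟨h1 | h1, h2⟩
    · exact h1
    · have h3 := hf _ h1
      rw [Perm.mul_apply, swap_apply_right] at h3
      have := v.injective (h3.trans h2.symm)
      rw [this] at h; omega

lemma step_half_left (h : P.val + 1 = Q.val) (hw : FixGe (Q.val + 1) w) (hp : w Q = P) :
    (B w).card = 2 * ((B w).filter (fun v => v Q = Q)).card := by
  have hp' : w⁻¹ P = Q := by rw [Perm.inv_eq_iff_eq, hp]
  have := step_half h hw.inv hp'
  rw [card_B_inv] at this
  rw [this, ← Finset.card_map (Equiv.inv (Perm (Fin n))).toEmbedding]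
  congr 2
  ext v
  rw [Finset.mem_map_equiv, Finset.mem_filter, Finset.mem_filter]
  have h1 := mem_B_inv v w
  have h2 : v⁻¹ Q = Q ↔ v Q = Q := by rw [Perm.inv_eq_iff_eq]; exact eq_comm
  exact and_congr h1 h2

/-- the key local analysis at the top -/
lemma top_cases (h : P.val + 1 = Q.val) (hw : FixGe (Q.val + 1) w) (hA : A321 w)
    (hQ : w Q ≠ Q) : w P = Q ∨ w Q = P ∨
      (w⁻¹ P < w⁻¹ Q ∧ w⁻¹ Q < P ∧ w Q < P ∧ w P < w Q) := by
  by_cases h1 : w P = Q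
  · exact Or.inl h1
  by_cases h2 : w Q = P
  · exact Or.inr (Or.inl h2)
  right; right
  have hp := hw.inv.lt (a := Q) (by omega)
  have hr := hw.inv.lt (a := P) (by omega)
  have hq := hw.lt (a := Q) (by omega)
  have ht := hw.lt (a := P) (by omega)
  have e1 : w (w⁻¹ Q) = Q := by simp
  have e2 : w (w⁻¹ P) = P := by simp
  generalize w⁻¹ Q = p at *
  generalize w⁻¹ P = r at *
  have n1 : p ≠ Q := by rintro rfl; exact hQ e1
  have n2 : p ≠ P := by rintro rfl; exact h1 e1
  have n3 : r ≠ Q := by rintro rfl; exact h2 e2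
  have n4 : r ≠ p := by rintro rfl; rw [e1] at e2; rw [e2] at h; omega
  have n5 : w P ≠ w Q := by simp [Fin.ext_iff]; omega
  have hPQ : P < Q := by rw [Fin.lt_def]; omega
  have l1 : w Q < P := by
    rw [Fin.lt_def]; rw [Ne, Fin.ext_iff] at hQ; rw [Fin.ext_iff] at h2; omega
  have l2 : p < P := by
    rw [Fin.lt_def]; rw [Ne, Fin.ext_iff] at n1 n2; omega
  have l3 : r < Q := by
    rw [Fin.lt_def]; rw [Ne, Fin.ext_iff] at n3; omega
  refine ⟨?_, l2, l1, ?_⟩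
  · rcases lt_trichotomy r p with h5 | h5 | h5
    · exact h5
    · exact absurd h5 n4
    · exact (hA p r Q h5 l3 (by rw [e2]; exact l1) (by rw [e1, e2]; exact hPQ)).elim
  · rcases lt_trichotomy (w P) (w Q) with h5 | h5 | h5
    · exact h5
    · exact absurd h5 n5
    · refine (hA p P Q l2 hPQ h5 ?_).elim
      rw [e1, Fin.lt_def]; rw [Fin.ext_iff] at h1; omega

lemma top_cases' (h : P.val + 1 = Q.val) (hw : FixGe (Q.val + 1) w) (hA : A321 w)
    (hB : A3412 w) (hQ : w Q ≠ Q) : w P = Q ∨ w Q = P := by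
  rcases top_cases h hw hA hQ with h1 | h1 | ⟨h1, h2, h3, h4⟩
  · exact Or.inl h1
  · exact Or.inr h1
  · exfalso
    refine hB _ _ _ _ ⟨h1, h2, (by rw [Fin.lt_def]; omega : P < Q), h4, ?_, ?_⟩
    · simpa using h3
    · simp [Fin.lt_def, -Fin.val_fin_lt]; omega

end Step

lemma fix_zero {n : ℕ} {w : Perm (Fin n)} (h : FixGe 0 w) : w = 1 := by
  ext i; simp [h i]

/-- for fixing the top point -/
lemma fix_down {n N : ℕ} {w : Perm (Fin n)} (hw : FixGe (N + 1) w)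
    (h : ∀ i : Fin n, i.val = N → w i = i) : FixGe N w := by
  intro i hi
  rcases Nat.eq_or_lt_of_le hi with e | e
  · exact h i e.symm
  · exact hw i e

lemma exists_P {n N : ℕ} {w : Perm (Fin n)} (hw : FixGe (N + 1) w) {Q : Fin n} (hQ : Q.val = N)
    (hne : w Q ≠ Q) : ∃ P : Fin n, P.val + 1 = Q.val := by
  have := hw.lt (a := Q) (by omega)
  rw [Ne, Fin.ext_iff] at hne
  exact ⟨⟨Q.val - 1, by omega⟩, by simp; omega⟩

theorem bool_card {n : ℕ} (N : ℕ) (w : Perm (Fin n)) (hw : FixGe N w) (hA : A321 w)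
    (hB : A3412 w) : (B w).card = 2 ^ inv w := by
  induction N generalizing w with
  | zero => rw [fix_zero hw, B_one, inv_one]; simp
  | succ N ih =>
    by_cases hf : ∀ i : Fin n, i.val = N → w i = i
    · exact ih w (fix_down hw hf) hA hB
    push Not at hf
    obtain ⟨Q, rfl, hne⟩ := hf
    obtain ⟨P, h⟩ := exists_P hw rfl hne
    have main : ∀ w : Perm (Fin n), FixGe (Q.val + 1) w → A321 w → A3412 w → w P = Q →
        (B w).card = 2 ^ inv w := by
      intro w hw hA hB h1
      rw [step_card h hw h1, step_inv h hw h1, ih _ (step_fix h hw h1) (step_321 h hw h1 hA)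
        (step_3412 h hw h1 hB)]
      ring
    rcases top_cases' h hw hA hB hne with h1 | h1
    · exact main w hw hA hB h1
    · rw [← card_B_inv, ← inv_inv]
      exact main _ hw.inv hA.inv hB.inv (by rw [Perm.inv_eq_iff_eq, h1])

end

section
open Equiv

section CaseB
variable {n : ℕ} {P Q R : Fin n}

lemma caseB_lts (hR : R.val + 1 = P.val) (h : P.val + 1 = Q.val) {u : Perm (Fin n)}
    (hu : FixGe P.val u) :
    u⁻¹ R < u⁻¹ P ∧ (swap R P * u) P < (swap R P * u) Q ∧
      (swap R P * u * swap P Q) R < (swap R P * u * swap P Q) P := by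
  have uP : u P = P := hu P le_rfl
  have uQ : u Q = Q := hu Q (by omega)
  have nRP : R ≠ P := by rw [Ne, Fin.ext_iff]; omega
  have nPQ : P ≠ Q := by rw [Ne, Fin.ext_iff]; omega
  have nRQ : R ≠ Q := by rw [Ne, Fin.ext_iff]; omega
  have xQ : swap R P Q = Q := swap_apply_of_ne_of_ne nRQ.symm nPQ.symm
  have yR : swap P Q R = R := swap_apply_of_ne_of_ne nRP nRQ
  refine ⟨?_, ?_, ?_⟩
  · have h1 := hu.inv.lt (a := R) (by omega)
    rw [hu.inv P le_rfl, Fin.lt_def]; exact h1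
  · rw [Perm.mul_apply, Perm.mul_apply, uP, uQ, xQ, swap_apply_right, Fin.lt_def]; omega
  · simp only [Perm.mul_apply]
    rw [yR, swap_apply_left, uQ, xQ, Fin.lt_def, swap_val]
    have := hu.lt (a := R) (by omega)
    split_ifs <;> omega

lemma caseB_inv (hR : R.val + 1 = P.val) (h : P.val + 1 = Q.val) {u : Perm (Fin n)}
    (hu : FixGe P.val u) :
    inv (swap R P * u * swap P Q * swap R P) = inv u + 3 := by
  obtain ⟨h1, h2, h3⟩ := caseB_lts hR h hu
  rw [inv_mul_swap _ _ _ hR h3, inv_mul_swap _ _ _ h h2, inv_left _ _ _ hR h1]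

open Classical in
lemma caseB_card (hR : R.val + 1 = P.val) (h : P.val + 1 = Q.val) {u : Perm (Fin n)}
    (hu : FixGe P.val u) (hh : (B u).card = 2 * ((B u).filter (fun v => v R = R)).card) :
    (B (swap R P * u * swap P Q * swap R P)).card = 7 * (B u).card := by
  obtain ⟨h1, h2, h3⟩ := caseB_lts hR h hu
  have nRP : R ≠ P := by rw [Ne, Fin.ext_iff]; omega
  have nPQ : P ≠ Q := by rw [Ne, Fin.ext_iff]; omega
  have nRQ : R ≠ Q := by rw [Ne, Fin.ext_iff]; omega
  have xQ : swap R P Q = Q := swap_apply_of_ne_of_ne nRQ.symm nPQ.symm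
  have yR : swap P Q R = R := swap_apply_of_ne_of_ne nRP nRQ
  have mE := fun v => mem_B_left v u R P hR h1
  have mD := fun v => mem_B_right v _ P Q h h2
  have mW := fun v => mem_B_right v _ R P hR h3
  have fA : ∀ v ∈ B u, v P = P ∧ v Q = Q := fun v hv =>
    ⟨B_fix hu v hv P le_rfl, B_fix hu v hv Q (by omega)⟩
  have xx : swap R P * swap R P = 1 := swap_mul_self _ _
  have yy : swap P Q * swap P Q = 1 := swap_mul_self _ _
  have xR : swap R P R = P := swap_apply_left _ _
  have xP : swap R P P = R := swap_apply_right _ _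
  have yP : swap P Q P = Q := swap_apply_left _ _
  have yQ : swap P Q Q = P := swap_apply_right _ _
  generalize hD : B (swap R P * u * swap P Q) = D at *
  generalize hE : B (swap R P * u) = E at *
  generalize B (swap R P * u * swap P Q * swap R P) = W at *
  generalize hA : B u = A at *
  generalize hx : swap R P = x at *
  generalize hy : swap P Q = y at *
  have xinv : x⁻¹ = x := by rw [inv_eq_iff_mul_eq_one, xx]
  have fE : ∀ v ∈ E, v Q = Q := by
    intro v hv
    rcases (mE v).1 hv with h4 | h4
    · exact (fA v h4).2
    · have := (fA _ h4).2
      rw [Perm.mul_apply] at this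
      apply x.injective; rw [this, xQ]
  -- cardinality of E
  have cE : E.card = 2 * A.card := by
    have : E = A ∪ A.map (Equiv.mulLeft x).toEmbedding := by
      ext v
      rw [mE, Finset.mem_union, Finset.mem_map_equiv]
      simp [xinv]
    rw [this, Finset.card_union_of_disjoint, Finset.card_map]
    · ring
    · rw [Finset.disjoint_left]
      intro v hv hv'
      rw [Finset.mem_map_equiv] at hv'
      simp [xinv] at hv'
      have e1 := (fA _ hv).1
      have e2 := (fA _ hv').1
      rw [Perm.mul_apply, e1, xP] at e2
      exact nRP e2
  have cD : D.card = 2 * E.card := by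
    apply card_double _ _ y yy mD
    rw [← hy]; exact not_mem_of_fix h fE
  -- the intersection
  have hW : W = D ∪ D.map (Equiv.mulRight x).toEmbedding := by
    ext v
    rw [mW, Finset.mem_union, Finset.mem_map_equiv]
    simp [xinv]
  have cW := Finset.card_union_add_card_inter D (D.map (Equiv.mulRight x).toEmbedding)
  rw [← hW, Finset.card_map] at cW
  have comm : ∀ v ∈ A, v R = R → v * x = x * v := by
    intro v hv hvR
    rw [← hx, Equiv.mul_swap_eq_swap_mul, hvR, (fA v hv).1]
  have nax : ∀ a ∈ A, a * x ∉ A := by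
    intro a ha hc
    have e1 := (fA a ha).1
    have e2 := (fA _ hc).1
    rw [Perm.mul_apply, xP] at e2
    exact nRP (a.injective (e2.trans e1.symm))
  have hI : D ∩ D.map (Equiv.mulRight x).toEmbedding =
      A.filter (fun v => v R = R) ∪
        (A.filter (fun v => v R = R)).map (Equiv.mulLeft x).toEmbedding := by
    ext d
    rw [Finset.mem_inter, Finset.mem_union, Finset.mem_map_equiv, Finset.mem_map_equiv,
      Finset.mem_filter, Finset.mem_filter]
    have s1 : (Equiv.mulRight x).symm d = d * x := by simp [xinv]
    have s2 : (Equiv.mulLeft x).symm d = x * d := by simp [xinv]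
    rw [s1, s2]
    constructor
    · rintro ⟨d1, d2⟩
      have dE : d ∈ E := by
        rcases (mD d).1 d1 with h4 | h4
        · exact h4
        exfalso
        have g1 := fE _ h4
        rcases (mD _).1 d2 with h5 | h5
        · have g2 := fE _ h5
          rw [Perm.mul_apply, yQ] at g1
          rw [Perm.mul_apply, xQ] at g2
          exact nPQ (d.injective (g1.trans g2.symm))
        · have g2 := fE _ h5
          rw [Perm.mul_apply, yQ] at g1
          rw [Perm.mul_apply, yQ, Perm.mul_apply, xP] at g2
          exact nRP (d.injective (g2.trans g1.symm))
      have dxE : d * x ∈ E := by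
        rcases (mD _).1 d2 with h4 | h4
        · exact h4
        exfalso
        have g1 := fE _ h4
        have g2 := fE _ dE
        rw [Perm.mul_apply, yQ, Perm.mul_apply, xP] at g1
        exact nRQ (d.injective (g1.trans g2.symm))
      rcases (mE _).1 dE with h4 | h4
      · left
        refine ⟨h4, ?_⟩
        rcases (mE _).1 dxE with h5 | h5
        · exact absurd h5 (nax _ h4)
        · have := (fA _ h5).1
          rw [Perm.mul_apply, Perm.mul_apply, xP] at this
          apply x.injective; rw [this, xR]
      · right
        refine ⟨h4, ?_⟩
        rcases (mE _).1 dxE with h5 | h5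
        · have := (fA _ h5).1
          rw [Perm.mul_apply, xP] at this
          rw [Perm.mul_apply, this, xP]
        · rw [← mul_assoc] at h5
          exact absurd h5 (nax _ h4)
    · rintro (⟨a1, a2⟩ | ⟨a1, a2⟩)
      · refine ⟨(mD _).2 (Or.inl ((mE _).2 (Or.inl a1))),
          (mD _).2 (Or.inl ((mE _).2 (Or.inr ?_)))⟩
        rw [comm d a1 a2, ← mul_assoc, xx, one_mul]; exact a1
      · refine ⟨(mD _).2 (Or.inl ((mE _).2 (Or.inr a1))),
          (mD _).2 (Or.inl ((mE _).2 (Or.inl ?_)))⟩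
        have := comm _ a1 a2
        rw [← mul_assoc, xx, one_mul, mul_assoc] at this
        have e : d * x = x * d := by
          have h5 : x * (x * (d * x)) = x * d := by rw [this]
          rw [← mul_assoc, xx, one_mul] at h5
          exact h5
        rw [e]; exact a1
  have cI : (D ∩ D.map (Equiv.mulRight x).toEmbedding).card = A.card := by
    rw [hI, Finset.card_union_of_disjoint, Finset.card_map, hh]
    · ring
    · rw [Finset.disjoint_left]
      intro v hv hv'
      rw [Finset.mem_map_equiv] at hv'
      simp [xinv] at hv' hv
      have e1 := (fA _ hv.1).1
      have e2 := (fA _ hv'.1).1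
      rw [Perm.mul_apply, e1, xP] at e2
      exact nRP e2
  omega

/-- The structure at the top when the unique `3412` sits there. -/
lemma caseB_struct (h : P.val + 1 = Q.val) {w : Perm (Fin n)} (hw : FixGe (Q.val + 1) w)
    (hA : A321 w) (hU : U3412 w)
    (hc : w⁻¹ P < w⁻¹ Q ∧ w⁻¹ Q < P ∧ w Q < P ∧ w P < w Q) :
    ∃ R u : _, R.val + 1 = P.val ∧ FixGe P.val u ∧ A321 u ∧ A3412 u ∧ u R ≠ R ∧
      w = swap R P * u * swap P Q * swap R P := by
  obtain ⟨h1, h2, h3, h4⟩ := hc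
  have e1 : w (w⁻¹ Q) = Q := by simp
  have e2 : w (w⁻¹ P) = P := by simp
  generalize w⁻¹ Q = p at *
  generalize w⁻¹ P = r at *
  have hPQ : P < Q := by rw [Fin.lt_def]; omega
  have occ : Occ w r p P Q := ⟨h1, h2, hPQ, h4, by rw [e2]; exact h3, by rw [e1, e2]; exact hPQ⟩
  obtain ⟨a, b, c, d, -, hu⟩ := hU
  have huniq : ∀ a' b' c' d', Occ w a' b' c' d' → a' = r ∧ b' = p ∧ c' = P ∧ d' = Q := by
    intro a' b' c' d' ho
    obtain ⟨rfl, rfl, rfl, rfl⟩ := hu _ _ _ _ occ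
    exact hu _ _ _ _ ho
  have hlt := h2
  rw [Fin.lt_def] at hlt
  obtain ⟨R, hR⟩ : ∃ R : Fin n, R.val + 1 = P.val :=
    ⟨⟨P.val - 1, by omega⟩, by simp; omega⟩
  have hRP : R < P := by rw [Fin.lt_def]; omega
  have hRQ : R < Q := hRP.trans hPQ
  have pR : p = R := by
    by_contra hne
    have hp : p < R := by rw [Fin.lt_def]; rw [Fin.ext_iff] at hne; omega
    have wRQ : w R < Q := by
      have := hw.lt (a := R) (by omega)
      have : w R ≠ Q := by rw [← e1]; exact fun hh => hne (w.injective hh).symm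
      rw [Ne, Fin.ext_iff] at this
      rw [Fin.lt_def]; omega
    rcases lt_trichotomy (w R) (w Q) with h5 | h5 | h5
    · have := huniq r p R Q ⟨h1, hp, hRQ, h5, by rw [e2]; exact h3, by rw [e1, e2]; exact hPQ⟩
      exact hRP.ne this.2.2.1
    · exact hRQ.ne (w.injective h5)
    · exact hA p R Q hp hRQ h5 (by rw [e1]; exact wRQ)
  subst pR
  have wQ : w Q = p := by
    by_contra hne
    have hq : w Q < p := by rw [Fin.lt_def] at h3 ⊢; rw [Fin.ext_iff] at hne; omega
    have ez : w (w⁻¹ p) = p := by simp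
    have hz := hw.inv.lt (a := p) (by omega)
    generalize w⁻¹ p = z at *
    have zQ : z < Q := by
      have : z ≠ Q := by rintro rfl; exact hne ez
      rw [Ne, Fin.ext_iff] at this
      rw [Fin.lt_def]; omega
    rcases lt_trichotomy z p with h5 | h5 | h5
    · have := huniq z p P Q ⟨h5, h2, hPQ, h4, by rw [ez]; exact hq, by rw [e1, ez]; exact hRQ⟩
      rw [this.1, e2] at ez
      exact hRP.ne ez.symm
    · rw [h5, e1] at ez; exact hRQ.ne ez.symm
    · exact hA p z Q h5 zQ (by rw [ez]; exact hq) (by rw [e1, ez]; exact hRQ)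
  rw [wQ] at h4
  have xQ : swap p P Q = Q := swap_apply_of_ne_of_ne hRQ.ne' hPQ.ne'
  have yR : swap P Q p = p := swap_apply_of_ne_of_ne hRP.ne hRQ.ne
  have hw' : w = swap p P * (swap p P * w * swap p P * swap P Q) * swap P Q * swap p P := by
    ext i; simp
  have hfix : FixGe P.val (swap p P * w * swap p P * swap P Q) := by
    intro i hi
    simp only [Perm.mul_apply]
    by_cases i1 : i = P
    · rw [i1, swap_apply_left, xQ, wQ, swap_apply_left]
    by_cases i2 : i = Q
    · rw [i2, swap_apply_right, swap_apply_right, e1, xQ]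
    have hi' : Q.val + 1 ≤ i.val := by rw [Fin.ext_iff] at i1 i2; omega
    have i3 : i ≠ p := by rw [Ne, Fin.ext_iff]; omega
    rw [swap_apply_of_ne_of_ne i1 i2, swap_apply_of_ne_of_ne i3 i1, hw i hi',
      swap_apply_of_ne_of_ne i3 i1]
  have hfg : ∀ a : Fin n, a.val < P.val →
      w (swap p P a) = swap p P ((swap p P * w * swap p P * swap P Q) a) := by
    intro a ha
    simp only [Perm.mul_apply, swap_apply_self]
    rw [swap_apply_of_ne_of_ne (a := P) (b := Q) (x := a)]
    · rw [Ne, Fin.ext_iff]; omega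
    · rw [Ne, Fin.ext_iff]; omega
  have hf := swap_mono hR
  refine ⟨p, swap p P * w * swap p P * swap P Q, hR, hfix, ?_, ?_, ?_, hw'⟩
  · exact transfer321 hfix (swap p P) (swap p P) hf hf hfg hA
  · intro a b c d ho
    have := (huniq _ _ _ _ (transfer3412 hfix (swap p P) (swap p P) hf hf hfg ho)).2.2.2
    have hd := (ho.lt hfix).2.2.2
    rw [← xQ] at this
    have := (swap p P).injective this
    rw [this] at hd; omega
  · simp only [Perm.mul_apply]
    rw [yR, swap_apply_left]
    intro hh
    have : w P = P := by
      apply (swap p P).injective; rw [hh, swap_apply_right]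
    rw [this] at h4
    exact absurd h4 hRP.not_gt

end CaseB

theorem main_card {n : ℕ} (N : ℕ) (w : Perm (Fin n)) (hw : FixGe N w) (hA : A321 w)
    (hU : U3412 w) : 3 ≤ inv w ∧ (B w).card = 7 * 2 ^ (inv w - 3) := by
  induction N generalizing w with
  | zero =>
    obtain ⟨a, b, c, d, ho, -⟩ := hU
    have := (ho.lt hw).1
    omega
  | succ N ih =>
    by_cases hf : ∀ i : Fin n, i.val = N → w i = i
    · exact ih w (fix_down hw hf) hA hU
    push Not at hf
    obtain ⟨Q, rfl, hne⟩ := hf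
    obtain ⟨P, h⟩ := exists_P hw rfl hne
    have main : ∀ w : Perm (Fin n), FixGe (Q.val + 1) w → A321 w → U3412 w → w P = Q →
        3 ≤ inv w ∧ (B w).card = 7 * 2 ^ (inv w - 3) := by
      intro w hw hA hU h1
      obtain ⟨i1, i2⟩ := ih _ (step_fix h hw h1) (step_321 h hw h1 hA) (step_U h hw h1 hU)
      rw [step_card h hw h1, step_inv h hw h1, i2]
      refine ⟨by omega, ?_⟩
      rw [Nat.sub_add_comm i1, pow_succ]
      ring
    rcases top_cases h hw hA hne with h1 | h1 | hc
    · exact main w hw hA hU h1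
    · rw [← card_B_inv, ← inv_inv]
      exact main _ hw.inv hA.inv hU.inv (by rw [Perm.inv_eq_iff_eq, h1])
    · obtain ⟨R, u, hR, hu, uA, uB, uR, hwu⟩ := caseB_struct h hw hA hU hc
      have hu' : FixGe (R.val + 1) u := by rw [hR]; exact hu
      obtain ⟨O, hO⟩ := exists_P hu' rfl uR
      have half : (B u).card = 2 * ((B u).filter (fun v => v R = R)).card := by
        rcases top_cases' hO hu' uA uB uR with h5 | h5
        · exact step_half hO hu' h5
        · exact step_half_left hO hu' h5
      have c1 := caseB_inv hR h hu
      have c2 := caseB_card hR h hu half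
      rw [← hwu] at c1 c2
      rw [c1, c2, bool_card _ u hu uA uB]
      exact ⟨by omega, rfl⟩

lemma A321_of_avoids {n : ℕ} {w : Perm (Fin n)} (h : AvoidsA w p321) : A321 w := by
  intro a b c h1 h2 h3 h4
  apply h
  refine ⟨![a, b, c], ?_, ?_⟩
  · rw [Fin.strictMono_iff_lt_succ]
    intro i; fin_cases i
    · exact h1
    · exact h2
  · have h5 := h3.trans h4
    intro i j
    fin_cases i <;> fin_cases j <;>
      simp [p321, h3, h4, h5, h3.le, h4.le, h5.le]

end

theorem stmt5 (n : ℕ) (w : Equiv.Perm (Fin n))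
    (h321 : AvoidsA w p321)
    (h3412 : ∃! t : Fin n × Fin n × Fin n × Fin n,
      t.1 < t.2.1 ∧ t.2.1 < t.2.2.1 ∧ t.2.2.1 < t.2.2.2 ∧
        w t.2.2.1 < w t.2.2.2 ∧ w t.2.2.2 < w t.1 ∧ w t.1 < w t.2.1) :
    Nat.card {v : Equiv.Perm (Fin n) // bruhatA n v w} = 7 * 2 ^ (lenA n w - 3) := by
  rw [card_B, lenA_eq]
  refine (main_card n w (fun i hi => absurd i.2 (by omega)) (A321_of_avoids h321) ?_).2
  obtain ⟨⟨a, b, c, d⟩, h1, h2⟩ := h3412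
  refine ⟨a, b, c, d, h1, ?_⟩
  intro a' b' c' d' ho
  have := h2 (a', b', c', d') ho
  simpa using this

end Paper
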